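/- Let δ₀ ∈ (0, π), M > 0, a ∈ (0,1) and 0 < c₀ ≤ C₀. Let ρ be a probability density on [−π,π] with ρ(x) = ρ(−x), supported in [−Θ,Θ] for some 0 < Θ ≤ π − δ₀, with ρ ≤ M almost everywhere and c₀√x ≤ ρ(Θ−x) ≤ C₀√x for 0 < x < a. Then there exist ε > 0 and d > 0, depending only on δ₀, M, a, c₀, C₀, such that for every z = r·e^{i(Θ+κ)} with 0 ≤ r − 1 < ε and 0 < κ < ε one has Im f_ρ(z) − Im f_ρ(e^{iΘ}) ≤ −d·√κ. -/

import Mathlib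

open MeasureTheory

noncomputable section

/-- The Cauchy transform of an integrable density `ρ` on `[−π, π]`:
`f_ρ(z) = ∫_{−π}^{π} (e^{iθ} + z)/(e^{iθ} − z)·ρ(θ) dθ`. -/
def cauchyTransformD (ρ : ℝ → ℝ) (z : ℂ) : ℂ :=
  ∫ θ in (-Real.pi)..Real.pi,
    ((Complex.exp ((θ : ℂ) * Complex.I) + z) / (Complex.exp ((θ : ℂ) * Complex.I) - z)) *
      (ρ θ : ℂ)

/-- `ρ` is a symmetric probability density on `[−π, π]` supported in `[−Θ, Θ]`, bounded
a.e. by `M`, with square-root behavior `c₀√x ≤ ρ(Θ−x) ≤ C₀√x` for `0 < x < a`. -/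
def IsEdgeDensity (Θ M a c₀ C₀ : ℝ) (ρ : ℝ → ℝ) : Prop :=
  (∀ x, 0 ≤ ρ x) ∧ (∫ x in (-Real.pi)..Real.pi, ρ x) = 1 ∧ (∀ x, ρ x = ρ (-x)) ∧
    (∀ x, Θ < |x| → ρ x = 0) ∧ (∀ᵐ x ∂(volume : Measure ℝ), ρ x ≤ M) ∧
    (∀ x, 0 < x → x < a →
      c₀ * Real.sqrt x ≤ ρ (Θ - x) ∧ ρ (Θ - x) ≤ C₀ * Real.sqrt x)

open Set

/-- The imaginary part of the Cauchy kernel at angle `u` and radius `r`. -/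
def kernelIm (r u : ℝ) : ℝ := 2 * r * Real.sin u / (1 + r ^ 2 - 2 * r * Real.cos u)

theorem im_cauchyKernel (r φ θ : ℝ) :
    ((Complex.exp ((θ : ℂ) * Complex.I) + (r : ℂ) * Complex.exp ((φ : ℂ) * Complex.I)) /
      (Complex.exp ((θ : ℂ) * Complex.I) - (r : ℂ) * Complex.exp ((φ : ℂ) * Complex.I))).im =
      kernelIm r (φ - θ) := by
  rw [Complex.div_im]
  simp only [Complex.normSq_apply, Complex.add_re, Complex.add_im, Complex.sub_re, Complex.sub_im,
    Complex.mul_re, Complex.mul_im, Complex.ofReal_re, Complex.ofReal_im,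
    Complex.exp_ofReal_mul_I_re, Complex.exp_ofReal_mul_I_im, kernelIm]
  rw [← sub_div]
  rw [Real.sin_sub, Real.cos_sub]
  congr 1
  · ring
  · linear_combination (r ^ 2) * Real.sin_sq_add_cos_sq φ + Real.sin_sq_add_cos_sq θ

theorem kernelIm_eq_half (r u : ℝ) :
    kernelIm r u = 4 * r * Real.sin (u / 2) * Real.cos (u / 2) /
      ((r - 1) ^ 2 + 4 * r * Real.sin (u / 2) ^ 2) := by
  have h1 : Real.sin u = 2 * Real.sin (u / 2) * Real.cos (u / 2) := by
    rw [← Real.sin_two_mul]; ring_nf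
  have h2 : Real.cos u = 1 - 2 * Real.sin (u / 2) ^ 2 := by
    have := Real.cos_two_mul (u / 2)
    have h3 := Real.sin_sq_add_cos_sq (u / 2)
    rw [show 2 * (u / 2) = u by ring] at this
    linarith
  rw [kernelIm, h1, h2]
  congr 1 <;> ring

theorem kernelIm_one {x : ℝ} (hs : Real.sin (x / 2) ≠ 0) :
    kernelIm 1 x = Real.cos (x / 2) / Real.sin (x / 2) := by
  rw [kernelIm_eq_half]
  field_simp
  ring

/-- Increasing the radius damps the kernel by an explicit amount. -/
theorem kernelIm_eq_cot_sub {r u : ℝ} (hr : 1 ≤ r) (hs : 0 < Real.sin (u / 2)) :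
    kernelIm r u = Real.cos (u / 2) / Real.sin (u / 2) -
      Real.cos (u / 2) * (r - 1) ^ 2 /
        (Real.sin (u / 2) * ((r - 1) ^ 2 + 4 * r * Real.sin (u / 2) ^ 2)) := by
  rw [kernelIm_eq_half]
  have hD : 0 < (r - 1) ^ 2 + 4 * r * Real.sin (u / 2) ^ 2 := by positivity
  field_simp
  ring

theorem cot_sub_cot {x κ : ℝ} (hs : Real.sin (x / 2) ≠ 0) (hS : Real.sin ((x + κ) / 2) ≠ 0) :
    Real.cos (x / 2) / Real.sin (x / 2) - Real.cos ((x + κ) / 2) / Real.sin ((x + κ) / 2) =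
      Real.sin (κ / 2) / (Real.sin (x / 2) * Real.sin ((x + κ) / 2)) := by
  have h : Real.sin (κ / 2) = Real.sin ((x + κ) / 2) * Real.cos (x / 2) -
      Real.cos ((x + κ) / 2) * Real.sin (x / 2) := by
    rw [← Real.sin_sub]; ring_nf
  rw [h]
  field_simp

theorem kernelIm_sub_le {δ r x κ t : ℝ} (hδ : 0 < δ) (hδπ : δ < Real.pi) (hr : 1 ≤ r)
    (hrt : r - 1 ≤ t) (hκ : 0 < κ) (hκδ : κ ≤ δ) (hx : 0 < x)
    (hxδ : x ≤ 2 * Real.pi - 2 * δ) :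
    kernelIm r (x + κ) - kernelIm 1 x ≤ 1 / (4 * Real.sin (δ / 2) ^ 3) * t ^ 2 := by
  have hδs : 0 < Real.sin (δ / 2) := Real.sin_pos_of_pos_of_lt_pi (by linarith) (by linarith)
  have hs : 0 < Real.sin (x / 2) := Real.sin_pos_of_pos_of_lt_pi (by linarith) (by linarith)
  have hS : 0 < Real.sin ((x + κ) / 2) :=
    Real.sin_pos_of_pos_of_lt_pi (by linarith) (by linarith)
  have hκs : 0 ≤ Real.sin (κ / 2) :=
    Real.sin_nonneg_of_nonneg_of_le_pi (by linarith) (by linarith)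
  rw [kernelIm_one hs.ne', kernelIm_eq_cot_sub hr hS]
  have hcot := cot_sub_cot hs.ne' hS.ne'
  have h0 : 0 ≤ Real.sin (κ / 2) / (Real.sin (x / 2) * Real.sin ((x + κ) / 2)) := by positivity
  rcases le_or_gt 0 (Real.cos ((x + κ) / 2)) with hC | hC
  · have : 0 ≤ Real.cos ((x + κ) / 2) * (r - 1) ^ 2 /
        (Real.sin ((x + κ) / 2) * ((r - 1) ^ 2 + 4 * r * Real.sin ((x + κ) / 2) ^ 2)) := by
      positivity
    have h2 : 0 ≤ 1 / (4 * Real.sin (δ / 2) ^ 3) * t ^ 2 := by positivity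
    linarith
  · have hSδ : Real.sin (δ / 2) ≤ Real.sin ((x + κ) / 2) := by
      have hgt : Real.pi / 2 < (x + κ) / 2 := by
        by_contra! hle
        exact absurd hC (not_lt.2 (Real.cos_nonneg_of_neg_pi_div_two_le_of_le
          (by linarith) hle))
      rw [← Real.sin_pi_sub ((x + κ) / 2)]
      exact Real.sin_le_sin_of_le_of_le_pi_div_two (by linarith) (by linarith) (by linarith)
    have key : -Real.cos ((x + κ) / 2) * (r - 1) ^ 2 /
        (Real.sin ((x + κ) / 2) * ((r - 1) ^ 2 + 4 * r * Real.sin ((x + κ) / 2) ^ 2)) ≤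
        t ^ 2 / (4 * Real.sin (δ / 2) ^ 3) := by
      have hcos : -Real.cos ((x + κ) / 2) ≤ 1 := by linarith [Real.neg_one_le_cos ((x + κ) / 2)]
      have hden : Real.sin (δ / 2) * (4 * Real.sin (δ / 2) ^ 2) ≤ Real.sin ((x + κ) / 2) *
          ((r - 1) ^ 2 + 4 * r * Real.sin ((x + κ) / 2) ^ 2) := by
        have h2 : Real.sin (δ / 2) ^ 2 ≤ Real.sin ((x + κ) / 2) ^ 2 := by gcongr
        have h3 : Real.sin ((x + κ) / 2) ^ 2 ≤ r * Real.sin ((x + κ) / 2) ^ 2 :=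
          le_mul_of_one_le_left (by positivity) hr
        gcongr
        nlinarith [sq_nonneg (r - 1)]
      have hnum : -Real.cos ((x + κ) / 2) * (r - 1) ^ 2 ≤ t ^ 2 := by
        have h2 : (r - 1) ^ 2 ≤ t ^ 2 := by
          have : 0 ≤ r - 1 := by linarith
          gcongr
        nlinarith [sq_nonneg (r - 1)]
      rw [show 4 * Real.sin (δ / 2) ^ 3 = Real.sin (δ / 2) * (4 * Real.sin (δ / 2) ^ 2) by ring]
      gcongr
    have e1 : -Real.cos ((x + κ) / 2) * (r - 1) ^ 2 /
        (Real.sin ((x + κ) / 2) * ((r - 1) ^ 2 + 4 * r * Real.sin ((x + κ) / 2) ^ 2)) =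
        -(Real.cos ((x + κ) / 2) * (r - 1) ^ 2 /
        (Real.sin ((x + κ) / 2) * ((r - 1) ^ 2 + 4 * r * Real.sin ((x + κ) / 2) ^ 2))) := by
      ring
    have e2 : 1 / (4 * Real.sin (δ / 2) ^ 3) * t ^ 2 = t ^ 2 / (4 * Real.sin (δ / 2) ^ 3) := by
      ring
    rw [e1] at key
    rw [e2]
    linarith

theorem half_le_sin {y : ℝ} (h0 : 0 ≤ y) (h1 : y ≤ 1) : y / 2 ≤ Real.sin y := by
  rcases h0.eq_or_lt with rfl | h0
  · simp
  · have := Real.sin_gt_sub_cube h0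
    nlinarith [mul_nonneg h0.le (mul_nonneg (sub_nonneg.2 h1) h0.le),
      mul_nonneg h0.le (sub_nonneg.2 h1)]

theorem kernelIm_sub_le_neg {r x κ t : ℝ} (ht : 0 < t) (ht2 : t ≤ 1 / 2) (hr : 1 ≤ r)
    (hκ : 0 < κ) (htm : t = max κ (r - 1)) (hx : t ≤ x) (hx2 : x ≤ 2 * t) :
    kernelIm r (x + κ) - kernelIm 1 x ≤ -(1 / (57 * t)) := by
  have hκt : κ ≤ t := htm ▸ le_max_left _ _
  have hrt : r - 1 ≤ t := htm ▸ le_max_right _ _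
  have hπ := Real.pi_gt_three
  have hs : 0 < Real.sin (x / 2) := Real.sin_pos_of_pos_of_lt_pi (by linarith) (by linarith)
  have hS : 0 < Real.sin ((x + κ) / 2) :=
    Real.sin_pos_of_pos_of_lt_pi (by linarith) (by linarith)
  have hκs : κ / 4 ≤ Real.sin (κ / 2) := by
    have := half_le_sin (y := κ / 2) (by linarith) (by linarith)
    linarith
  have hst : Real.sin (x / 2) ≤ t := by
    have := Real.sin_le (x := x / 2) (by linarith)
    linarith
  have hSt : Real.sin ((x + κ) / 2) ≤ 3 * t / 2 := by
    have := Real.sin_le (x := (x + κ) / 2) (by linarith)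
    linarith
  have hC : 1 / 2 ≤ Real.cos ((x + κ) / 2) := by
    have := Real.one_sub_sq_div_two_le_cos (x := (x + κ) / 2)
    nlinarith
  rw [kernelIm_one hs.ne', kernelIm_eq_cot_sub hr hS]
  have hcot := cot_sub_cot hs.ne' hS.ne'
  have hdamp : 0 ≤ Real.cos ((x + κ) / 2) * (r - 1) ^ 2 /
      (Real.sin ((x + κ) / 2) * ((r - 1) ^ 2 + 4 * r * Real.sin ((x + κ) / 2) ^ 2)) := by
    positivity
  have hshift : 0 ≤ Real.sin (κ / 2) / (Real.sin (x / 2) * Real.sin ((x + κ) / 2)) := by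
    have : 0 ≤ Real.sin (κ / 2) := by linarith
    positivity
  rcases max_choice κ (r - 1) with h | h
  · rw [h] at htm
    subst htm
    have : 1 / (57 * t) ≤ Real.sin (t / 2) / (Real.sin (x / 2) * Real.sin ((x + t) / 2)) := by
      calc 1 / (57 * t) ≤ 1 / (6 * t) := by gcongr; norm_num
        _ = (t / 4) / (t * (3 * t / 2)) := by field_simp; norm_num
        _ ≤ _ := by gcongr; linarith
    linarith
  · rw [h] at htm
    have hD : (r - 1) ^ 2 + 4 * r * Real.sin ((x + κ) / 2) ^ 2 ≤ 19 * t ^ 2 := by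
      have h1 : Real.sin ((x + κ) / 2) ^ 2 ≤ (3 * t / 2) ^ 2 := by gcongr
      have h2 : 4 * r * Real.sin ((x + κ) / 2) ^ 2 ≤ 8 * (3 * t / 2) ^ 2 := by
        gcongr
        linarith
      rw [← htm]
      linarith
    have : 1 / (57 * t) ≤ Real.cos ((x + κ) / 2) * (r - 1) ^ 2 /
        (Real.sin ((x + κ) / 2) * ((r - 1) ^ 2 + 4 * r * Real.sin ((x + κ) / 2) ^ 2)) := by
      calc 1 / (57 * t) = (1 / 2 * t ^ 2) / ((3 * t / 2) * (19 * t ^ 2)) := by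
            field_simp; norm_num
        _ ≤ _ := by rw [← htm] at hD ⊢; gcongr
    linarith

theorem intervalIntegral_eq_setIntegral_Ioo {E : Type*} [NormedAddCommGroup E] [NormedSpace ℝ E]
    {f : ℝ → E} {b c : ℝ} (hbc : b < c) (h0 : 0 < b) (hf : ∀ x, b < |x| → f x = 0) :
    ∫ x in (-c)..c, f x = ∫ x in Ioo (-b) b, f x := by
  rw [intervalIntegral.integral_of_le (by linarith), ← integral_Icc_eq_integral_Ioo]
  apply setIntegral_eq_of_subset_of_forall_sdiff_eq_zero measurableSet_Ioc
  · intro x hx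
    exact ⟨by linarith [hx.1], by linarith [hx.2]⟩
  · intro x hx
    apply hf
    by_contra! h
    exact hx.2 (abs_le.1 h)

theorem integrableOn_mul_of_continuousOn_Icc {ρ : ℝ → ℝ} {K : ℝ → ℂ} {b c : ℝ}
    (hρ : IntegrableOn ρ (Icc b c)) (hK : ContinuousOn K (Icc b c)) :
    IntegrableOn (fun θ => K θ * (ρ θ : ℂ)) (Icc b c) :=
  IntegrableOn.continuousOn_mul hK hρ.ofReal isCompact_Icc

theorem normSq_exp_sub (r φ θ : ℝ) :
    Complex.normSq (Complex.exp ((θ : ℂ) * Complex.I) -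
      (r : ℂ) * Complex.exp ((φ : ℂ) * Complex.I)) =
      (r - 1) ^ 2 + 4 * r * Real.sin ((φ - θ) / 2) ^ 2 := by
  have h2 : Real.cos (φ - θ) = 1 - 2 * Real.sin ((φ - θ) / 2) ^ 2 := by
    have := Real.cos_two_mul ((φ - θ) / 2)
    have h3 := Real.sin_sq_add_cos_sq ((φ - θ) / 2)
    rw [show 2 * ((φ - θ) / 2) = φ - θ by ring] at this
    linarith
  rw [Real.cos_sub] at h2
  simp only [Complex.normSq_apply, Complex.sub_re, Complex.sub_im,
    Complex.mul_re, Complex.mul_im, Complex.ofReal_re, Complex.ofReal_im,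
    Complex.exp_ofReal_mul_I_re, Complex.exp_ofReal_mul_I_im]
  linear_combination (r ^ 2) * Real.sin_sq_add_cos_sq φ + Real.sin_sq_add_cos_sq θ - 2 * r * h2

theorem continuousOn_cauchyKernel {r φ : ℝ} {s : Set ℝ} (hr : 1 ≤ r)
    (h : ∀ θ ∈ s, 0 < φ - θ ∧ φ - θ < 2 * Real.pi) :
    ContinuousOn (fun θ : ℝ =>
      (Complex.exp ((θ : ℂ) * Complex.I) + (r : ℂ) * Complex.exp ((φ : ℂ) * Complex.I)) /
      (Complex.exp ((θ : ℂ) * Complex.I) - (r : ℂ) * Complex.exp ((φ : ℂ) * Complex.I))) s := by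
  refine ContinuousOn.div (by fun_prop) (by fun_prop) fun θ hθ h0 => ?_
  have h1 := normSq_exp_sub r φ θ
  have hs : 0 < Real.sin ((φ - θ) / 2) :=
    Real.sin_pos_of_pos_of_lt_pi (by linarith [h θ hθ]) (by linarith [h θ hθ])
  rw [h0, map_zero] at h1
  have : 0 < (r - 1) ^ 2 + 4 * r * Real.sin ((φ - θ) / 2) ^ 2 := by positivity
  linarith

theorem norm_cauchyKernel_le {φ θ : ℝ} (h0 : 0 < φ - θ) (h1 : φ - θ ≤ 1) :
    ‖(Complex.exp ((θ : ℂ) * Complex.I) + Complex.exp ((φ : ℂ) * Complex.I)) /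
      (Complex.exp ((θ : ℂ) * Complex.I) - Complex.exp ((φ : ℂ) * Complex.I))‖ ≤
      4 / (φ - θ) := by
  have hs := half_le_sin (y := (φ - θ) / 2) (by linarith) (by linarith)
  have hn := normSq_exp_sub 1 φ θ
  rw [Complex.ofReal_one, one_mul, Complex.normSq_eq_norm_sq] at hn
  have hden : (φ - θ) / 2 ≤
      ‖Complex.exp ((θ : ℂ) * Complex.I) - Complex.exp ((φ : ℂ) * Complex.I)‖ := by
    refine (pow_le_pow_iff_left₀ (by linarith) (norm_nonneg _) two_ne_zero).1 ?_
    rw [hn]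
    nlinarith
  have hnum : ‖Complex.exp ((θ : ℂ) * Complex.I) + Complex.exp ((φ : ℂ) * Complex.I)‖ ≤ 2 := by
    refine (norm_add_le _ _).trans ?_
    rw [Complex.norm_exp_ofReal_mul_I, Complex.norm_exp_ofReal_mul_I]
    norm_num
  rw [norm_div]
  calc _ ≤ 2 / ((φ - θ) / 2) := by gcongr
    _ = 4 / (φ - θ) := by field_simp; norm_num

theorem integrableOn_edge {Θ a C₀ : ℝ} {ρ : ℝ → ℝ} (ha : 0 < a) (ha1 : a < 1)
    (haΘ : a ≤ 2 * Θ) (hΘπ : Θ < Real.pi) (h0 : ∀ x, 0 ≤ ρ x)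
    (hρ : IntegrableOn ρ (Icc (-Θ) Θ))
    (hub : ∀ x, 0 < x → x < a → ρ (Θ - x) ≤ C₀ * Real.sqrt x) :
    IntegrableOn (fun θ : ℝ =>
      ((Complex.exp ((θ : ℂ) * Complex.I) + Complex.exp ((Θ : ℂ) * Complex.I)) /
      (Complex.exp ((θ : ℂ) * Complex.I) - Complex.exp ((Θ : ℂ) * Complex.I))) * (ρ θ : ℂ))
      (Ioo (-Θ) Θ) := by
  have hcont (s : Set ℝ) (hs : ∀ θ ∈ s, 0 < Θ - θ ∧ Θ - θ < 2 * Real.pi) :=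
    continuousOn_cauchyKernel (r := 1) (φ := Θ) le_rfl hs
  simp only [Complex.ofReal_one, one_mul] at hcont
  have hunion : Ioo (-Θ) Θ ⊆ Icc (-Θ) (Θ - a / 2) ∪ Ioo (Θ - a / 2) Θ := by
    intro x hx
    rcases le_or_gt x (Θ - a / 2) with h | h
    · exact Or.inl ⟨hx.1.le, h⟩
    · exact Or.inr ⟨h, hx.2⟩
  refine IntegrableOn.mono_set (IntegrableOn.union ?_ ?_) hunion
  · refine integrableOn_mul_of_continuousOn_Icc (hρ.mono_set (Icc_subset_Icc_right (by linarith)))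
      (hcont _ fun θ hθ => ⟨by linarith [hθ.2], by linarith [hθ.1]⟩)
  · have hdom : IntegrableOn (fun θ => 4 * C₀ * (Θ - θ) ^ (-(1 / 2) : ℝ))
        (Ioo (Θ - a / 2) Θ) := by
      have h1 := (intervalIntegral.intervalIntegrable_rpow' (a := a / 2) (b := 0)
        (r := -(1 / 2)) (by norm_num)).comp_sub_left Θ
      rw [sub_zero, intervalIntegrable_iff_integrableOn_Ioo_of_le (by linarith)] at h1
      exact h1.const_mul _
    refine Integrable.mono' hdom ?_ ?_
    · refine AEStronglyMeasurable.mul ?_ ?_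
      · exact (hcont _ fun θ hθ => ⟨by linarith [hθ.2], by linarith [hθ.1]⟩).aestronglyMeasurable
          measurableSet_Ioo
      · exact (hρ.mono_set (fun x hx => ⟨by linarith [hx.1], hx.2.le⟩)).ofReal.aestronglyMeasurable
    · refine (ae_restrict_iff' measurableSet_Ioo).2 (Filter.Eventually.of_forall fun θ hθ => ?_)
      have hx0 : 0 < Θ - θ := by linarith [hθ.2]
      have hb := hub (Θ - θ) hx0 (by linarith [hθ.1])
      rw [sub_sub_cancel] at hb
      rw [norm_mul, Complex.norm_real, Real.norm_of_nonneg (h0 θ)]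
      calc _ ≤ 4 / (Θ - θ) * (C₀ * Real.sqrt (Θ - θ)) :=
            mul_le_mul (norm_cauchyKernel_le hx0 (by linarith [hθ.1])) hb (h0 θ) (by positivity)
        _ = 4 * C₀ * (Θ - θ) ^ (-(1 / 2) : ℝ) := by
            rw [Real.rpow_neg hx0.le, ← Real.sqrt_eq_rpow]
            have hq : Real.sqrt (Θ - θ) ≠ 0 := (Real.sqrt_pos.2 hx0).ne'
            have := Real.sq_sqrt hx0.le
            field_simp
            linear_combination (C₀) * this

theorem setIntegral_le_of_le_sub_indicator {s J : Set ℝ} {f g : ℝ → ℝ} {c : ℝ}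
    (hs : MeasurableSet s) (hJ : MeasurableSet J) (hJs : J ⊆ s) (hJf : volume J ≠ ⊤)
    (hf : IntegrableOn f s) (hg : IntegrableOn g s)
    (h : ∀ x ∈ s, f x ≤ g x) (h' : ∀ x ∈ J, f x ≤ g x - c) :
    ∫ x in s, f x ≤ (∫ x in s, g x) - c * (volume J).toReal := by
  have hind : IntegrableOn (J.indicator fun _ => c) s := by
    refine Integrable.integrableOn ?_
    rw [integrable_indicator_iff hJ]
    exact integrableOn_const hJf
  have hc : ∫ x in s, J.indicator (fun _ => c) x = c * (volume J).toReal := by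
    rw [setIntegral_indicator hJ, inter_eq_self_of_subset_right hJs, setIntegral_const]
    simp [Measure.real, mul_comm]
  rw [← hc, ← integral_sub hg hind]
  refine setIntegral_mono_on hf (hg.sub hind) hs fun x hx => ?_
  by_cases hxJ : x ∈ J
  · simpa [hxJ] using h' x hxJ
  · simpa [hxJ] using h x hx

/-- For a density with square-root edge behavior as above, there exist
`ε > 0` and `d > 0`, depending only on `δ₀, M, a, c₀, C₀`, such that for every
`z = r·e^{i(Θ+κ)}` with `0 ≤ r − 1 < ε` and `0 < κ < ε`, one has
`Im f_ρ(z) − Im f_ρ(e^{iΘ}) ≤ −d·√κ`. -/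
theorem stmt_15 (δ₀ M a c₀ C₀ : ℝ) (hδ₀ : 0 < δ₀) (hδ₀' : δ₀ < Real.pi) (hM : 0 < M)
    (ha : 0 < a) (ha1 : a < 1) (hc₀ : 0 < c₀) (hc₀C₀ : c₀ ≤ C₀) :
    ∃ ε d : ℝ, 0 < ε ∧ 0 < d ∧
      ∀ Θ : ℝ, 0 < Θ → Θ ≤ Real.pi - δ₀ →
      ∀ ρ : ℝ → ℝ, IsEdgeDensity Θ M a c₀ C₀ ρ →
      ∀ r κ : ℝ, 0 ≤ r - 1 → r - 1 < ε → 0 < κ → κ < ε →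
        (cauchyTransformD ρ
              ((r : ℂ) * Complex.exp (((Θ + κ : ℝ) : ℂ) * Complex.I))).im -
            (cauchyTransformD ρ (Complex.exp ((Θ : ℂ) * Complex.I))).im ≤
          -d * Real.sqrt κ := by
  have hs : 0 < Real.sin (δ₀ / 2) := Real.sin_pos_of_pos_of_lt_pi (by linarith) (by linarith)
  set C : ℝ := 1 / (4 * Real.sin (δ₀ / 2) ^ 3)
  have hCpos : 0 < C := by positivity
  refine ⟨min (min (1 / 2) (a / 3)) (min δ₀ (c₀ / (114 * C))), c₀ / 114, ?_, by positivity, ?_⟩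
  · have : 0 < c₀ / (114 * C) := by positivity
    simp only [lt_min_iff]
    exact ⟨⟨by norm_num, by linarith⟩, hδ₀, this⟩
  rintro Θ hΘ hΘδ ρ ⟨h0, hone, -, hsupp, -, hedge⟩ r κ hr hrε hκ hκε
  obtain ⟨t, ht⟩ : ∃ t, t = max κ (r - 1) := ⟨_, rfl⟩
  have hκt : κ ≤ t := ht ▸ le_max_left _ _
  have hrt : r - 1 ≤ t := ht ▸ le_max_right _ _
  have htε : t < min (min (1 / 2) (a / 3)) (min δ₀ (c₀ / (114 * C))) := ht ▸ max_lt hκε hrε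
  simp only [lt_min_iff] at htε
  obtain ⟨⟨ht2, hta⟩, htδ, htC⟩ := htε
  have ht0 : 0 < t := hκ.trans_le hκt
  have hΘπ : Θ < Real.pi := by linarith
  have haΘ : a ≤ 2 * Θ := by
    by_contra! hlt
    have h1 := (hedge ((2 * Θ + a) / 2) (by linarith) (by linarith)).1
    rw [hsupp _ (lt_abs.2 (Or.inr (by linarith)))] at h1
    have h2 : 0 < c₀ * Real.sqrt ((2 * Θ + a) / 2) :=
      mul_pos hc₀ (Real.sqrt_pos.2 (by linarith))
    linarith
  have hρ : IntegrableOn ρ (Icc (-Θ) Θ) := by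
    have h1 : IntervalIntegrable ρ volume (-Real.pi) Real.pi := by
      by_contra h
      rw [intervalIntegral.integral_undef h] at hone
      exact zero_ne_one hone
    rw [intervalIntegrable_iff_integrableOn_Ioc_of_le (by linarith)] at h1
    exact h1.mono_set fun x hx => ⟨by linarith [hx.1], by linarith [hx.2]⟩
  have hρ' : IntegrableOn ρ (Ioo (-Θ) Θ) := hρ.mono_set Ioo_subset_Icc_self
  rw [intervalIntegral_eq_setIntegral_Ioo hΘπ hΘ hsupp] at hone
  have htrans (z : ℂ) := intervalIntegral_eq_setIntegral_Ioo (f := fun θ : ℝ =>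
    ((Complex.exp ((θ : ℂ) * Complex.I) + z) / (Complex.exp ((θ : ℂ) * Complex.I) - z)) *
      (ρ θ : ℂ)) hΘπ hΘ (fun x hx => by simp [hsupp x hx])
  simp only [cauchyTransformD, htrans]
  have hint1 := (integrableOn_mul_of_continuousOn_Icc hρ (continuousOn_cauchyKernel (r := r)
    (φ := Θ + κ) (s := Icc (-Θ) Θ) (by linarith)
    fun θ hθ => ⟨by linarith [hθ.2], by linarith [hθ.1]⟩)).mono_set Ioo_subset_Icc_self
  have hint2 := integrableOn_edge ha ha1 haΘ hΘπ h0 hρ fun x hx hxa => (hedge x hx hxa).2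
  have him (θ : ℝ) :
      (((Complex.exp ((θ : ℂ) * Complex.I) +
          (r : ℂ) * Complex.exp (((Θ + κ : ℝ) : ℂ) * Complex.I)) /
        (Complex.exp ((θ : ℂ) * Complex.I) -
          (r : ℂ) * Complex.exp (((Θ + κ : ℝ) : ℂ) * Complex.I))) * (ρ θ : ℂ) -
      ((Complex.exp ((θ : ℂ) * Complex.I) + Complex.exp ((Θ : ℂ) * Complex.I)) /
        (Complex.exp ((θ : ℂ) * Complex.I) - Complex.exp ((Θ : ℂ) * Complex.I))) *
          (ρ θ : ℂ)).im =
      (kernelIm r (Θ - θ + κ) - kernelIm 1 (Θ - θ)) * ρ θ := by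
    have h1 := im_cauchyKernel 1 Θ θ
    rw [Complex.ofReal_one, one_mul] at h1
    rw [Complex.sub_im, Complex.im_mul_ofReal, Complex.im_mul_ofReal, im_cauchyKernel, h1,
      show Θ + κ - θ = Θ - θ + κ by ring]
    ring
  rw [← Complex.sub_im, ← integral_sub hint1 hint2]
  have hint := (hint1.sub hint2).im
  have himint := integral_im (hint1.sub hint2)
  simp only [Pi.sub_apply, RCLike.im_to_complex, him] at hint himint
  rw [← himint]
  have hsqrt : 0 < Real.sqrt t := Real.sqrt_pos.2 ht0
  have hpt : ∀ θ ∈ Ioo (-Θ) Θ,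
      (kernelIm r (Θ - θ + κ) - kernelIm 1 (Θ - θ)) * ρ θ ≤ C * t ^ 2 * ρ θ := fun θ hθ =>
    mul_le_mul_of_nonneg_right (kernelIm_sub_le hδ₀ hδ₀' (by linarith) hrt hκ (by linarith)
      (by linarith [hθ.2]) (by linarith [hθ.1])) (h0 θ)
  have hptJ : ∀ θ ∈ Icc (Θ - 2 * t) (Θ - t),
      (kernelIm r (Θ - θ + κ) - kernelIm 1 (Θ - θ)) * ρ θ ≤
        C * t ^ 2 * ρ θ - 1 / (57 * t) * (c₀ * Real.sqrt t) := by
    intro θ hθ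
    have h1 := kernelIm_sub_le_neg (x := Θ - θ) ht0 ht2.le (by linarith) hκ ht
      (by linarith [hθ.2]) (by linarith [hθ.1])
    have h2 := (hedge (Θ - θ) (by linarith [hθ.2]) (by linarith [hθ.1])).1
    rw [sub_sub_cancel] at h2
    have h3 : c₀ * Real.sqrt t ≤ ρ θ := by
      refine le_trans ?_ h2
      gcongr
      linarith [hθ.2]
    have h4 := mul_le_mul_of_nonneg_right h1 (h0 θ)
    have h5 : 1 / (57 * t) * (c₀ * Real.sqrt t) ≤ 1 / (57 * t) * ρ θ := by gcongr
    have h6 : 0 ≤ C * t ^ 2 * ρ θ := by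
      have := h0 θ
      positivity
    linarith
  have hmain := setIntegral_le_of_le_sub_indicator measurableSet_Ioo measurableSet_Icc
    (fun x hx => ⟨by linarith [hx.1], by linarith [hx.2]⟩) (by simp) hint
    (hρ'.const_mul (C * t ^ 2)) hpt hptJ
  rw [integral_const_mul, hone, Real.volume_Icc, ENNReal.toReal_ofReal (by linarith)] at hmain
  refine hmain.trans ?_
  have h1 : 1 / (57 * t) * (c₀ * Real.sqrt t) * (Θ - t - (Θ - 2 * t)) =
      2 * (c₀ / 114 * Real.sqrt t) := by
    field_simp
    ring
  have h2 : C * t ^ 2 ≤ c₀ / 114 * Real.sqrt t := by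
    have h3 : t * C ≤ c₀ / 114 := by
      rw [lt_div_iff₀ (by positivity)] at htC
      linarith
    have h4 : t ≤ Real.sqrt t := Real.le_sqrt_of_sq_le (by nlinarith)
    calc C * t ^ 2 = (t * C) * t := by ring
      _ ≤ _ := by gcongr
  have h3 : c₀ / 114 * Real.sqrt κ ≤ c₀ / 114 * Real.sqrt t := by gcongr
  rw [h1]
  linarith

end
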